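/- There exist constants s ∈ (0,1) and C > 0 such that every bubble F of the basilica polynomial f satisfies diam(F) ≤ C · s^{Gen(F)}. In particular, for every infinite bubble ray (F_k)_{k≥0} of f there exists a unique point x ∈ ℂ such that the bubbles F_k converge to x in the Hausdorff sense, i.e. for every ε > 0 one has F_k ⊆ B(x, ε) for all sufficiently large k. -/

import Mathlib

open Filter Topology

/-- The basilica polynomial `f(z) = z² − 1`. -/
noncomputable def fBasilica : ℂ → ℂ := fun z => z ^ 2 - 1

/-- The basin of attraction of the superattracting 2-cycle `0 ↦ −1 ↦ 0`. -/
def basilicaBasin : Set ℂ :=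
  {z | Tendsto (fun n => fBasilica^[2 * n] z) atTop (𝓝 0) ∨
       Tendsto (fun n => fBasilica^[2 * n] z) atTop (𝓝 (-1))}

/-- A bubble is a connected component of the basin. -/
def IsBubble (F : Set ℂ) : Prop :=
  ∃ z ∈ basilicaBasin, F = connectedComponentIn basilicaBasin z

/-- The bubble containing `0`. -/
noncomputable def B0 : Set ℂ := connectedComponentIn basilicaBasin 0

/-- The generation of a bubble: the least `n ≥ 0` with `f^[n] '' F ⊆ B0`. -/
noncomputable def bubbleGen (F : Set ℂ) : ℕ := sInf {n : ℕ | fBasilica^[n] '' F ⊆ B0}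

/-- A bubble ray: a sequence of bubbles whose consecutive closures meet in exactly one point,
with strictly increasing generations. -/
def IsBubbleRay (F : ℕ → Set ℂ) : Prop :=
  (∀ k, IsBubble (F k)) ∧
  (∀ k, ∃ x : ℂ, closure (F k) ∩ closure (F (k + 1)) = {x}) ∧
  (∀ k, bubbleGen (F k) < bubbleGen (F (k + 1)))


namespace Basilica

open Metric Set

/-- sub-basin: even iterates tend to zero -/
def bas0 : Set ℂ := {z | Tendsto (fun n => fBasilica^[2 * n] z) atTop (𝓝 0)}

/-- sub-basin: even iterates tend to minus one -/
def bas1 : Set ℂ := {z | Tendsto (fun n => fBasilica^[2 * n] z) atTop (𝓝 (-1))}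

lemma basin_eq : basilicaBasin = bas0 ∪ bas1 := rfl

lemma f_cont : Continuous fBasilica := by unfold fBasilica; fun_prop

lemma f_apply (z : ℂ) : fBasilica z = z ^ 2 - 1 := rfl

lemma ff_apply (z : ℂ) : fBasilica (fBasilica z) = z ^ 2 * (z ^ 2 - 2) := by
  simp only [f_apply]; ring

lemma iter_two_succ (n : ℕ) (z : ℂ) :
    fBasilica^[2 * (n + 1)] z = fBasilica^[2 * n] (fBasilica (fBasilica z)) := by
  rw [show 2 * (n + 1) = 2 * n + 1 + 1 by ring, Function.iterate_succ_apply,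
    Function.iterate_succ_apply]

lemma iter_two_succ' (n : ℕ) (z : ℂ) :
    fBasilica^[2 * (n + 1)] z = fBasilica (fBasilica (fBasilica^[2 * n] z)) := by
  rw [show 2 * (n + 1) = 2 * n + 1 + 1 by ring, Function.iterate_succ_apply',
    Function.iterate_succ_apply']

lemma iter_comm (n : ℕ) (z : ℂ) :
    fBasilica^[2 * n] (fBasilica z) = fBasilica (fBasilica^[2 * n] z) := by
  rw [← Function.iterate_succ_apply, Function.iterate_succ_apply']

lemma disj (z : ℂ) (h0 : z ∈ bas0) (h1 : z ∈ bas1) : False := by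
  have := tendsto_nhds_unique h0 h1
  norm_num at this

lemma ff_mem0 (z : ℂ) : fBasilica (fBasilica z) ∈ bas0 ↔ z ∈ bas0 := by
  unfold bas0
  simp only [mem_ofPred_eq]
  rw [← tendsto_add_atTop_iff_nat (f := fun n => fBasilica^[2 * n] z) 1]
  simp only [iter_two_succ]

lemma f_mem1_of (z : ℂ) (h : z ∈ bas0) : fBasilica z ∈ bas1 := by
  have h2 := (f_cont.tendsto 0).comp h
  simp only [f_apply 0] at h2
  norm_num at h2
  refine h2.congr fun n => ?_
  simp [iter_comm]

lemma f_mem0_of (z : ℂ) (h : z ∈ bas1) : fBasilica z ∈ bas0 := by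
  have h2 := (f_cont.tendsto (-1)).comp h
  simp only [f_apply (-1)] at h2
  norm_num at h2
  refine h2.congr fun n => ?_
  simp [iter_comm]

lemma f_mem0 (z : ℂ) : fBasilica z ∈ bas0 ↔ z ∈ bas1 := by
  refine ⟨fun h => ?_, f_mem0_of z⟩
  have h2 := f_mem1_of _ h
  have : Tendsto (fun n => fBasilica^[2 * (n+1)] z) atTop (𝓝 (-1)) := by
    simp only [iter_two_succ]; exact h2
  exact (tendsto_add_atTop_iff_nat (f := fun n => fBasilica^[2 * n] z) 1).1 this

lemma f_mem1 (z : ℂ) : fBasilica z ∈ bas1 ↔ z ∈ bas0 := by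
  rw [← f_mem0, ff_mem0]

lemma f_mem (z : ℂ) : fBasilica z ∈ basilicaBasin ↔ z ∈ basilicaBasin := by
  rw [basin_eq, mem_union, mem_union, f_mem0, f_mem1, or_comm]

lemma iter_mem0 (n : ℕ) (z : ℂ) : fBasilica^[2 * n] z ∈ bas0 ↔ z ∈ bas0 := by
  induction n with
  | zero => simp
  | succ n ih => rw [iter_two_succ', ff_mem0, ih]

lemma iter_mem (n : ℕ) (z : ℂ) : fBasilica^[n] z ∈ basilicaBasin ↔ z ∈ basilicaBasin := by
  induction n with
  | zero => simp
  | succ n ih => rw [Function.iterate_succ_apply', f_mem, ih]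

lemma ff_norm_le (z : ℂ) : ‖fBasilica (fBasilica z)‖ ≤ ‖z‖ ^ 2 * (‖z‖ ^ 2 + 2) := by
  rw [ff_apply, norm_mul, norm_pow]
  gcongr
  refine (norm_sub_le _ _).trans ?_
  simp

lemma ff_norm_small (z : ℂ) (h : ‖z‖ < 2 / 5) :
    ‖fBasilica (fBasilica z)‖ ≤ (9 / 10) * ‖z‖ := by
  refine (ff_norm_le z).trans ?_
  have h0 := norm_nonneg z
  have : ‖z‖ * (‖z‖ ^ 2 + 2) ≤ 9 / 10 := by nlinarith
  nlinarith

lemma ball_sub0 : ball (0 : ℂ) (2 / 5) ⊆ bas0 := by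
  intro z hz
  rw [mem_ball_zero_iff] at hz
  have key : ∀ n, ‖fBasilica^[2 * n] z‖ ≤ (9 / 10) ^ n * (2 / 5) ∧
      ‖fBasilica^[2 * n] z‖ < 2 / 5 := by
    intro n
    induction n with
    | zero => simpa using ⟨hz.le, hz⟩
    | succ n ih =>
      rw [iter_two_succ']
      have := ff_norm_small _ ih.2
      have h0 := norm_nonneg (fBasilica^[2 * n] z)
      constructor
      · rw [pow_succ]; linarith [ih.1]
      · linarith [ih.2]
  refine squeeze_zero_norm (fun n => (key n).1) ?_
  have := (tendsto_pow_atTop_nhds_zero_of_lt_one (r := (9 / 10 : ℝ)) (by norm_num)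
    (by norm_num)).mul_const (2 / 5)
  simpa using this

lemma zero_mem0 : (0 : ℂ) ∈ bas0 := ball_sub0 (by simp)

lemma neg_one_mem1 : (-1 : ℂ) ∈ bas1 := by
  rw [← f_mem0, f_apply]; norm_num; exact zero_mem0

lemma near_neg_one (z : ℂ) (h : z ∈ bas0) : 1 / 10 ≤ ‖z + 1‖ := by
  by_contra! hc
  have : fBasilica z ∈ bas0 := by
    apply ball_sub0
    rw [mem_ball_zero_iff, f_apply, show z ^ 2 - 1 = (z + 1) * ((z + 1) - 2) by ring, norm_mul]
    have h1 : ‖z + 1 - 2‖ ≤ ‖z + 1‖ + 2 := by simpa using norm_sub_le (z + 1) 2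
    have h0 := norm_nonneg (z + 1)
    nlinarith
  exact disj z h ((f_mem0 z).1 this)

lemma mono_iter (z : ℂ) {m n : ℕ} (hmn : m ≤ n)
    (h : fBasilica^[2 * m] z ∈ ball (0 : ℂ) (2 / 5)) :
    fBasilica^[2 * n] z ∈ ball (0 : ℂ) (2 / 5) := by
  induction n, hmn using Nat.le_induction with
  | base => exact h
  | succ n _ ih =>
    rw [iter_two_succ']
    rw [mem_ball_zero_iff] at ih ⊢
    have := ff_norm_small _ ih
    linarith [norm_nonneg (fBasilica^[2 * n] z)]

lemma exists_iter (z : ℂ) (h : z ∈ bas0) : ∃ m, fBasilica^[2 * m] z ∈ ball (0 : ℂ) (2 / 5) :=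
  (h.eventually (ball_mem_nhds 0 (by norm_num))).exists

lemma isOpen_pre (k : ℕ) : IsOpen (fBasilica^[2 * k] ⁻¹' ball (0 : ℂ) (2 / 5)) :=
  isOpen_ball.preimage (f_cont.iterate _)

lemma bas0_eq : bas0 = ⋃ k, fBasilica^[2 * k] ⁻¹' ball (0 : ℂ) (2 / 5) := by
  ext z
  simp only [mem_iUnion, mem_preimage]
  exact ⟨exists_iter z, fun ⟨m, hm⟩ => (iter_mem0 m z).1 (ball_sub0 hm)⟩

lemma isOpen_bas0 : IsOpen bas0 := by
  rw [bas0_eq]; exact isOpen_iUnion isOpen_pre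

lemma isOpen_bas1 : IsOpen bas1 := by
  have : bas1 = fBasilica ⁻¹' bas0 := by ext z; exact (f_mem0 z).symm
  rw [this]; exact isOpen_bas0.preimage f_cont

lemma isOpen_basin : IsOpen basilicaBasin := isOpen_bas0.union isOpen_bas1

lemma compact_iter {K : Set ℂ} (hK : IsCompact K) (h : K ⊆ bas0) :
    ∃ m, ∀ z ∈ K, fBasilica^[2 * m] z ∈ ball (0 : ℂ) (2 / 5) := by
  rw [bas0_eq] at h
  obtain ⟨m, hm⟩ := hK.elim_directed_cover _ isOpen_pre h
    (directed_of_isDirected_le fun m n hmn z hz => mono_iter z hmn hz)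
  exact ⟨m, fun z hz => hm hz⟩

lemma basin_norm (z : ℂ) (h : z ∈ basilicaBasin) : ‖z‖ ≤ 2 := by
  by_contra! hc
  have key : ∀ n, 2 < ‖fBasilica^[n] z‖ := by
    intro n
    induction n with
    | zero => simpa
    | succ n ih =>
      rw [Function.iterate_succ_apply', f_apply]
      have := norm_sub_norm_le ((fBasilica^[n] z) ^ 2) 1
      rw [norm_pow, norm_one] at this
      nlinarith
  rcases h with h | h
  · have := ge_of_tendsto h.norm (Eventually.of_forall fun n => (key (2 * n)).le)
    norm_num at this
  · have := ge_of_tendsto h.norm (Eventually.of_forall fun n => (key (2 * n)).le)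
    norm_num at this

lemma isBounded_basin : Bornology.IsBounded basilicaBasin :=
  (isBounded_closedBall (x := (0 : ℂ)) (r := 2)).subset fun z hz => by
    simpa using basin_norm z hz

lemma zero_mem : (0 : ℂ) ∈ basilicaBasin := Or.inl zero_mem0

lemma B0_sub0 : B0 ⊆ bas0 := by
  have h1 : B0 ⊆ bas0 ∪ bas1 := connectedComponentIn_subset _ _
  refine isPreconnected_connectedComponentIn.subset_left_of_subset_union isOpen_bas0 isOpen_bas1
    ?_ h1 ⟨0, mem_connectedComponentIn zero_mem, zero_mem0⟩
  exact Set.disjoint_left.2 fun z h0 h1 => disj z h0 h1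

lemma sub_B0 {S : Set ℂ} (hS : IsPreconnected S) (hb : S ⊆ basilicaBasin)
    (hm : (S ∩ B0).Nonempty) : S ⊆ B0 := by
  obtain ⟨x, hx, hx0⟩ := hm
  have := hS.subset_connectedComponentIn hx hb
  rwa [← connectedComponentIn_eq hx0] at this

lemma ball_B0 : ball (0 : ℂ) (2 / 5) ⊆ B0 :=
  sub_B0 (convex_ball _ _).isPreconnected (fun z hz => Or.inl (ball_sub0 hz))
    ⟨0, by simp, mem_connectedComponentIn zero_mem⟩

/-- Square roots on the unit disc. -/
lemma exists_sqrt (g : ℂ → ℂ) (hg : DifferentiableOn ℂ g (ball 0 1))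
    (h0 : ∀ z ∈ ball (0 : ℂ) 1, g z ≠ 0) :
    ∃ r : ℂ → ℂ, DifferentiableOn ℂ r (ball 0 1) ∧ ∀ z ∈ ball (0 : ℂ) 1, r z ^ 2 = g z := by
  have hd : DifferentiableOn ℂ (fun z => deriv g z / g z) (ball 0 1) :=
    (hg.deriv isOpen_ball).div hg h0
  obtain ⟨L, hL⟩ := hd.isExactOn_ball
  have hLd : DifferentiableOn ℂ L (ball 0 1) := fun z hz =>
    (hL z hz).differentiableAt.differentiableWithinAt
  have hconst : ∀ z ∈ ball (0 : ℂ) 1, g z * Complex.exp (-L z) = g 0 * Complex.exp (-L 0) := by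
    intro z hz
    have hF : ∀ y ∈ ball (0 : ℂ) 1, HasDerivAt (fun y => g y * Complex.exp (-L y)) 0 y := by
      intro y hy
      have h1 : HasDerivAt g (deriv g y) y :=
        (hg.differentiableAt (isOpen_ball.mem_nhds hy)).hasDerivAt
      have h2 := h1.mul ((hL y hy).neg.cexp)
      refine h2.congr_deriv ?_
      have := h0 y hy
      field_simp
      ring
    exact (convex_ball (0 : ℂ) 1).is_const_of_fderivWithin_eq_zero (𝕜 := ℂ)
      (fun y hy => (hF y hy).differentiableAt.differentiableWithinAt)
      (fun y hy => by
        have := (hF y hy).hasFDerivAt.hasFDerivWithinAt (s := ball (0 : ℂ) 1)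
        rw [this.fderivWithin (isOpen_ball.uniqueDiffWithinAt hy)]
        ext; simp) hz (by simp)
  obtain ⟨c, hc⟩ := IsAlgClosed.exists_pow_nat_eq (g 0 * Complex.exp (-L 0)) (n := 2) (by norm_num)
  refine ⟨fun z => c * Complex.exp (L z / 2), by fun_prop, fun z hz => ?_⟩
  rw [mul_pow, hc, ← hconst z hz, ← Complex.exp_nat_mul, mul_assoc, ← Complex.exp_add]
  ring_nf
  simp

end Basilica

namespace Basilica

open Metric Set

/-- Approximate Boettcher parametrizations of the central bubble. -/
structure Good (k : ℕ) (ψ : ℂ → ℂ) : Prop where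
  diff : DifferentiableOn ℂ ψ (ball 0 1)
  fac : ∃ E : ℂ → ℂ, DifferentiableOn ℂ E (ball 0 1) ∧ (∀ w ∈ ball (0 : ℂ) 1, E w ≠ 0) ∧
    ∀ w ∈ ball (0 : ℂ) 1, ψ w = w * E w
  inj : InjOn ψ (ball 0 1)
  iter : ∀ w ∈ ball (0 : ℂ) 1, fBasilica^[2 * k] (ψ w) = (2 / 5) * w ^ (2 ^ k)
  low : ∀ w ∈ ball (0 : ℂ) 1, 2 / 5 * ‖w‖ ≤ ‖ψ w‖
  bd : ∀ (j : ℕ) (w : ℂ), w ∈ ball (0 : ℂ) 1 → 43 / 50 ≤ ‖w‖ → ‖w‖ ^ (2 ^ j) ≤ 93 / 100 →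
    ‖deriv ψ w‖ ^ 2 ≤ 40000 * (49 / 16) ^ j * (‖ψ w‖ * ‖ψ w + 1‖)

lemma mem0_of_iter {k : ℕ} {ψ : ℂ → ℂ}
    (h : ∀ w ∈ ball (0 : ℂ) 1, fBasilica^[2 * k] (ψ w) = (2 / 5) * w ^ (2 ^ k)) {w : ℂ}
    (hw : w ∈ ball (0 : ℂ) 1) : ψ w ∈ bas0 := by
  rw [← iter_mem0 k, h w hw]
  apply ball_sub0
  rw [mem_ball_zero_iff] at *
  rw [norm_mul, norm_pow]
  have : ‖w‖ ^ (2 ^ k) < 1 := pow_lt_one₀ (norm_nonneg _) hw (by positivity)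
  norm_num
  linarith

lemma Good.mem0 {k : ℕ} {ψ : ℂ → ℂ} (h : Good k ψ) {w : ℂ} (hw : w ∈ ball (0 : ℂ) 1) :
    ψ w ∈ bas0 := mem0_of_iter h.iter hw

lemma Good.zero {k : ℕ} {ψ : ℂ → ℂ} (h : Good k ψ) : ψ 0 = 0 := by
  obtain ⟨E, -, -, hE⟩ := h.fac
  rw [hE 0 (by simp)]; simp

lemma Good.eq_zero {k : ℕ} {ψ : ℂ → ℂ} (h : Good k ψ) {w : ℂ} (hw : w ∈ ball (0 : ℂ) 1)
    (h0 : ψ w = 0) : w = 0 := by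
  have := h.low w hw
  rw [h0, norm_zero] at this
  exact norm_le_zero_iff.1 (by linarith)

lemma sq_deriv {h g : ℂ → ℂ} (hh : DifferentiableOn ℂ h (ball 0 1))
    (he : ∀ w ∈ ball (0 : ℂ) 1, h w ^ 2 = g w + 1) {w : ℂ}
    (hw : w ∈ ball (0 : ℂ) 1) : 2 * h w * deriv h w = deriv g w := by
  have hb := isOpen_ball.mem_nhds hw
  have h1 : HasDerivAt h (deriv h w) w := (hh.differentiableAt hb).hasDerivAt
  have h2 : HasDerivAt (fun z => h z ^ 2 - 1) (2 * h w * deriv h w) w := by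
    simpa using (h1.pow 2).sub_const 1
  have h3 : g =ᶠ[𝓝 w] fun z => h z ^ 2 - 1 := by
    filter_upwards [hb] with z hz
    rw [he z hz]; ring
  rw [h3.deriv_eq, h2.deriv]

lemma cauchy_bd {ψ : ℂ → ℂ} (hd : DifferentiableOn ℂ ψ (ball 0 1))
    (h0 : ∀ w ∈ ball (0 : ℂ) 1, ψ w ∈ bas0)
    (low : ∀ w ∈ ball (0 : ℂ) 1, 2 / 5 * ‖w‖ ≤ ‖ψ w‖) {w : ℂ}
    (hw1 : 43 / 50 ≤ ‖w‖) (hw2 : ‖w‖ ≤ 93 / 100) :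
    ‖deriv ψ w‖ ^ 2 ≤ 40000 * (‖ψ w‖ * ‖ψ w + 1‖) := by
  have hw : w ∈ ball (0 : ℂ) 1 := by rw [mem_ball_zero_iff]; linarith
  have hsub : closedBall w (6 / 100) ⊆ ball 0 1 := by
    intro z hz
    rw [mem_closedBall, dist_eq_norm] at hz
    rw [mem_ball_zero_iff]
    have := norm_add_le (z - w) w
    rw [sub_add_cancel] at this
    linarith
  have h1 : ‖deriv ψ w‖ ≤ 2 / (6 / 100) := by
    refine Complex.norm_deriv_le_of_forall_mem_sphere_norm_le (by norm_num) ?_ ?_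
    · exact (hd.mono hsub).diffContOnCl_ball subset_rfl
    · intro z hz
      exact basin_norm _ (Or.inl (h0 z (hsub (sphere_subset_closedBall hz))))
  have h2 := low w hw
  have h3 := near_neg_one _ (h0 w hw)
  have h4 : (344 / 1000) * (1 / 10) ≤ ‖ψ w‖ * ‖ψ w + 1‖ := by
    apply mul_le_mul _ h3 (by norm_num) (norm_nonneg _)
    linarith
  have h5 : ‖deriv ψ w‖ ^ 2 ≤ (2 / (6 / 100)) ^ 2 := by gcongr
  norm_num at h5 h4 ⊢
  linarith

lemma good_zero : Good 0 (fun w => (2 / 5) * w) where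
  diff := by fun_prop
  fac := ⟨fun _ => 2 / 5, by fun_prop, fun _ _ => by norm_num, fun w _ => by ring⟩
  inj := by
    intro a _ b _ hab
    simpa using hab
  iter := by intro w _; simp
  low := by intro w _; simp
  bd := by
    intro j w hw hw1 _
    have hd : deriv (fun w : ℂ => (2 / 5) * w) w = 2 / 5 := by
      rw [deriv_const_mul _ differentiableAt_id]; simp
    rw [hd]
    rw [mem_ball_zero_iff] at hw
    have h1 : ‖(2 / 5 : ℂ) * w‖ = 2 / 5 * ‖w‖ := by simp
    have h2 : 1 - 2 / 5 * ‖w‖ ≤ ‖(2 / 5 : ℂ) * w + 1‖ := by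
      have := norm_sub_le ((2 / 5 : ℂ) * w + 1) ((2 / 5 : ℂ) * w)
      rw [h1] at this
      simp at this
      linarith
    rw [h1]
    have h3 : (1 : ℝ) ≤ (49 / 16) ^ j := one_le_pow₀ (by norm_num)
    have h4 : 2 / 5 * (43 / 50) * (3 / 5) ≤ 2 / 5 * ‖w‖ * ‖(2 / 5 : ℂ) * w + 1‖ := by
      apply mul_le_mul <;> nlinarith
    have h5 : ‖(2 / 5 : ℂ)‖ = 2 / 5 := by simp
    rw [h5]
    nlinarith

lemma sub_one_le {q : ℂ} (h : 2 / 5 ≤ ‖q‖) : ‖q - 1‖ ≤ 7 / 2 * ‖q‖ := by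
  have := norm_sub_le q 1
  rw [norm_one] at this
  linarith

lemma good_step {k : ℕ} {ψ : ℂ → ℂ} (h : Good k ψ) :
    ∃ q p : ℂ → ℂ, Good (k + 1) p ∧ DifferentiableOn ℂ q (ball 0 1) ∧
      (∀ w ∈ ball (0 : ℂ) 1, q w ^ 2 = ψ w + 1) ∧ q 0 = -1 ∧
      (∀ w ∈ ball (0 : ℂ) 1, p w ^ 2 = q (w ^ 2) + 1) ∧ ∀ w ∈ ball (0 : ℂ) 1, p (-w) = -p w := by
  have hne : ∀ w ∈ ball (0 : ℂ) 1, ψ w + 1 ≠ 0 := by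
    intro w hw h1
    have := near_neg_one _ (h.mem0 hw)
    rw [h1] at this
    norm_num at this
  obtain ⟨q, hqd, hq, hq0⟩ : ∃ q : ℂ → ℂ, DifferentiableOn ℂ q (ball 0 1) ∧
      (∀ w ∈ ball (0 : ℂ) 1, q w ^ 2 = ψ w + 1) ∧ q 0 = -1 := by
    obtain ⟨r, hr, hr2⟩ := exists_sqrt (fun w => ψ w + 1) (h.diff.add_const 1) hne
    have h0 := hr2 0 (by simp)
    simp only [h.zero, zero_add] at h0
    rcases (sq_eq_one_iff.1 h0 : r 0 = 1 ∨ r 0 = -1) with h1 | h1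
    · refine ⟨fun w => - r w, hr.neg, fun w hw => by rw [neg_sq, hr2 w hw], by simp [h1]⟩
    · exact ⟨r, hr, hr2, h1⟩
  obtain ⟨E, hEd, hE0, hE⟩ := h.fac
  have hq1 : ∀ w ∈ ball (0 : ℂ) 1, 1 - q w ≠ 0 := by
    intro w hw h1
    have h2 : q w = 1 := by linear_combination -h1
    have h3 := hq w hw
    rw [h2] at h3
    have h4 := h.eq_zero hw (by linear_combination -h3)
    rw [h4, hq0] at h2
    norm_num at h2
  obtain ⟨r, hrd, hr⟩ := exists_sqrt (fun w => - E w / (1 - q w))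
    (hEd.neg.div (hqd.const_sub 1) hq1)
    (fun w hw => div_ne_zero (neg_ne_zero.2 (hE0 w hw)) (hq1 w hw))
  have hsq : ∀ w ∈ ball (0 : ℂ) 1, w ^ 2 ∈ ball (0 : ℂ) 1 := by
    intro w hw
    rw [mem_ball_zero_iff] at *
    rw [norm_pow]
    exact pow_lt_one₀ (norm_nonneg _) hw (by norm_num)
  have hrE : DifferentiableOn ℂ (fun w => r (w ^ 2)) (ball 0 1) :=
    hrd.comp (f := fun w : ℂ => w ^ 2) (by fun_prop) hsq
  have hqE : DifferentiableOn ℂ (fun w => q (w ^ 2)) (ball 0 1) :=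
    hqd.comp (f := fun w : ℂ => w ^ 2) (by fun_prop) hsq
  have hpd : DifferentiableOn ℂ (fun w => w * r (w ^ 2)) (ball 0 1) :=
    differentiableOn_id.mul hrE
  have hr0 : ∀ w ∈ ball (0 : ℂ) 1, r (w ^ 2) ≠ 0 := by
    intro w hw h1
    have h2 := hr _ (hsq w hw)
    rw [h1] at h2
    exact div_ne_zero (neg_ne_zero.2 (hE0 _ (hsq w hw))) (hq1 _ (hsq w hw)) (by
      rw [← h2]; norm_num)
  have hp2 : ∀ w ∈ ball (0 : ℂ) 1, (w * r (w ^ 2)) ^ 2 = q (w ^ 2) + 1 := by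
    intro w hw
    rw [mul_pow, hr _ (hsq w hw)]
    have h1 := hq1 _ (hsq w hw)
    have h2 := hq _ (hsq w hw)
    rw [hE _ (hsq w hw)] at h2
    field_simp
    linear_combination h2
  have hpsi : ∀ w ∈ ball (0 : ℂ) 1, fBasilica (fBasilica (w * r (w ^ 2))) = ψ (w ^ 2) := by
    intro w hw
    rw [f_apply (w * r (w ^ 2)), hp2 w hw, f_apply, add_sub_cancel_right, hq _ (hsq w hw)]
    ring
  have hiter : ∀ w ∈ ball (0 : ℂ) 1,
      fBasilica^[2 * (k + 1)] (w * r (w ^ 2)) = (2 / 5) * w ^ (2 ^ (k + 1)) := by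
    intro w hw
    rw [iter_two_succ, hpsi w hw, h.iter _ (hsq w hw), ← pow_mul, pow_succ' 2 k]
  have hlow : ∀ w ∈ ball (0 : ℂ) 1, 2 / 5 * ‖w‖ ≤ ‖w * r (w ^ 2)‖ := by
    intro w hw
    by_contra! hc
    have h1 := ff_norm_le (w * r (w ^ 2))
    rw [hpsi w hw] at h1
    have h2 := h.low _ (hsq w hw)
    rw [norm_pow] at h2
    rw [mem_ball_zero_iff] at hw
    set x := ‖w * r (w ^ 2)‖
    have hx0 : 0 ≤ x := norm_nonneg _
    have hw0 : 0 ≤ ‖w‖ := norm_nonneg _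
    have h3 : x < 2 / 5 := by linarith
    have h4 : x ^ 2 < 4 / 25 * ‖w‖ ^ 2 := by nlinarith
    have h5 : x ^ 2 ≤ 4 / 25 := by nlinarith
    nlinarith
  have hbig : ∀ w ∈ ball (0 : ℂ) 1, 93 / 100 ≤ ‖w‖ → 2 / 5 ≤ ‖w * r (w ^ 2)‖ := by
    intro w hw hw1
    by_contra! hc
    have h1 := ff_norm_le (w * r (w ^ 2))
    rw [hpsi w hw] at h1
    have h2 := h.low _ (hsq w hw)
    rw [norm_pow] at h2
    set x := ‖w * r (w ^ 2)‖
    have hx0 : 0 ≤ x := norm_nonneg _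
    have h5 : x ^ 2 ≤ 4 / 25 := by nlinarith
    nlinarith
  have hqbig : ∀ w ∈ ball (0 : ℂ) 1, 2 / 5 ≤ ‖q w‖ := by
    intro w hw
    by_contra! hc
    refine disj (q w) (ball_sub0 (by simpa using hc)) ?_
    rw [← f_mem0, f_apply, hq w hw, add_sub_cancel_right]
    exact h.mem0 hw
  refine ⟨q, fun w => w * r (w ^ 2), ⟨hpd, ⟨_, hrE, hr0, fun w _ => rfl⟩, ?_, hiter, hlow, ?_⟩,
    hqd, hq, hq0, hp2, fun w _ => by simp⟩
  · intro a ha b hb hab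
    simp only at hab
    have h1 : a ^ 2 = b ^ 2 := by
      apply h.inj (hsq a ha) (hsq b hb)
      rw [← hpsi a ha, ← hpsi b hb, hab]
    rcases sq_eq_sq_iff_eq_or_eq_neg.1 h1 with h2 | h2
    · exact h2
    · rw [h1, h2] at hab
      have h3 := hr0 b hb
      have h4 : (2 * b) * r (b ^ 2) = 0 := by linear_combination -hab
      have h5 : b = 0 := by simpa [h3] using h4
      rw [h2, h5, neg_zero]
  · intro j w hw hw1 hwj
    have base : ‖w‖ ≤ 93 / 100 → ‖deriv (fun w => w * r (w ^ 2)) w‖ ^ 2 ≤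
        40000 * (49 / 16) ^ j * (‖w * r (w ^ 2)‖ * ‖w * r (w ^ 2) + 1‖) := by
      intro hw2
      refine (cauchy_bd hpd (fun w hw => mem0_of_iter (ψ := fun w => w * r (w ^ 2)) hiter hw) hlow
        hw1 hw2).trans ?_
      have h3 : (1 : ℝ) ≤ (49 / 16) ^ j := one_le_pow₀ (by norm_num)
      gcongr
      linarith
    by_cases hw2 : ‖w‖ ≤ 93 / 100
    · exact base hw2
    push Not at hw2
    cases j with
    | zero => exact base (by simpa using hwj)
    | succ j =>
    have hv := hsq w hw
    have ih := h.bd j (w ^ 2) hv (by rw [norm_pow]; nlinarith)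
      (by rw [norm_pow, ← pow_mul, ← pow_succ']; exact hwj)
    have e1 := sq_deriv hpd hp2 hw
    have e2 := sq_deriv hqd hq hv
    have e3 : deriv (fun w => q (w ^ 2)) w = deriv q (w ^ 2) * (2 * w) := by
      have h1 : HasDerivAt q (deriv q (w ^ 2)) (w ^ 2) :=
        (hqd.differentiableAt (isOpen_ball.mem_nhds hv)).hasDerivAt
      have h2 : HasDerivAt (fun w : ℂ => w ^ 2) (2 * w) w := by simpa using hasDerivAt_pow 2 w
      exact (h1.comp w h2).deriv
    rw [e3] at e1
    have hp := hbig w hw hw2.le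
    have hqq := hqbig _ hv
    have f1 := hp2 w hw
    have f2 := hq _ hv
    generalize hP : w * r (w ^ 2) = P at *
    generalize q (w ^ 2) = Q at *
    generalize deriv (fun w => w * r (w ^ 2)) w = P' at *
    generalize deriv q (w ^ 2) = Q' at *
    generalize deriv ψ (w ^ 2) = A' at *
    generalize ψ (w ^ 2) = A at *
    have g1 : P * P' = w * Q' := by linear_combination e1 / 2
    have g2 : A * (A + 1) = (Q - 1) * P ^ 2 * Q ^ 2 := by rw [f1, f2]; linear_combination -(A+1) * f2
    have n1 : ‖P‖ * ‖P'‖ = ‖w‖ * ‖Q'‖ := by rw [← norm_mul, ← norm_mul, g1]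
    have n2 : 2 * ‖Q‖ * ‖Q'‖ = ‖A'‖ := by rw [← e2]; simp
    have n3 : ‖A‖ * ‖A + 1‖ = ‖Q - 1‖ * ‖P‖ ^ 2 * ‖Q‖ ^ 2 := by
      rw [← norm_mul, g2]; simp
    have n4 : ‖Q‖ = ‖P - 1‖ * ‖P + 1‖ := by
      rw [← norm_mul]; congr 1; linear_combination -f1
    have n5 := sub_one_le hp
    have n6 := sub_one_le hqq
    rw [mem_ball_zero_iff] at hw
    rw [n3, ← n2] at ih
    have hPpos : 0 < ‖P‖ := by linarith
    have hQpos : 0 < ‖Q‖ := by linarith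
    have n7 : 4 * ‖Q'‖ ^ 2 ≤ 40000 * (49 / 16) ^ j * (‖Q - 1‖ * ‖P‖ ^ 2) := by
      have : 0 < ‖Q‖ ^ 2 := by positivity
      refine le_of_mul_le_mul_right ?_ this
      calc _ = (2 * ‖Q‖ * ‖Q'‖) ^ 2 := by ring
        _ ≤ _ := ih
        _ = _ := by ring
    have n8 : ‖P‖ ^ 2 * ‖P'‖ ^ 2 ≤ ‖Q'‖ ^ 2 := by
      rw [← mul_pow, n1, mul_pow]
      have : ‖w‖ ^ 2 ≤ 1 := pow_le_one₀ (norm_nonneg _) hw.le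
      nlinarith [sq_nonneg ‖Q'‖]
    have n9 : 4 * ‖P'‖ ^ 2 ≤ 40000 * (49 / 16) ^ j * ‖Q - 1‖ := by
      have : 0 < ‖P‖ ^ 2 := by positivity
      refine le_of_mul_le_mul_right ?_ this
      calc _ = 4 * (‖P‖ ^ 2 * ‖P'‖ ^ 2) := by ring
        _ ≤ 4 * ‖Q'‖ ^ 2 := by linarith
        _ ≤ _ := n7
        _ = _ := by ring
    have n10 : ‖Q - 1‖ ≤ 49 / 4 * (‖P‖ * ‖P + 1‖) := by
      have := mul_le_mul_of_nonneg_right n5 (norm_nonneg (P + 1))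
      rw [n4] at n6
      linarith
    have n11 : 40000 * (49 / 16 : ℝ) ^ j * ‖Q - 1‖ ≤
        40000 * (49 / 16 : ℝ) ^ j * (49 / 4 * (‖P‖ * ‖P + 1‖)) := by gcongr
    rw [pow_succ (49 / 16 : ℝ) j]
    linarith

lemma exists_good (k : ℕ) : ∃ ψ, Good k ψ := by
  induction k with
  | zero => exact ⟨_, good_zero⟩
  | succ k ih =>
    obtain ⟨ψ, h⟩ := ih
    obtain ⟨q, p, hp, -⟩ := good_step h
    exact ⟨p, hp⟩

end Basilica

namespace Basilica

open Metric Set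

lemma open_image {h : ℂ → ℂ} (hd : DifferentiableOn ℂ h (ball 0 1)) (hi : InjOn h (ball 0 1)) :
    IsOpen (h '' ball 0 1) := by
  have ha : AnalyticOnNhd ℂ h (ball 0 1) := hd.analyticOnNhd isOpen_ball
  rcases ha.is_constant_or_isOpen (convex_ball _ _).isPreconnected with ⟨c, hc⟩ | ho
  · exfalso
    have h0 : (0 : ℂ) ∈ ball (0 : ℂ) 1 := by simp
    have h1 : (1 / 2 : ℂ) ∈ ball (0 : ℂ) 1 := by simp; norm_num
    have := hi h0 h1 (by rw [hc _ h0, hc _ h1])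
    norm_num at this
  · exact ho _ subset_rfl isOpen_ball

lemma preconn_image {h : ℂ → ℂ} (hd : DifferentiableOn ℂ h (ball 0 1)) :
    IsPreconnected (h '' ball 0 1) :=
  (convex_ball (0 : ℂ) 1).isPreconnected.image _ hd.continuousOn

lemma Good.sub_B0 {k : ℕ} {ψ : ℂ → ℂ} (h : Good k ψ) : ψ '' ball 0 1 ⊆ B0 := by
  refine Basilica.sub_B0 (preconn_image h.diff) ?_ ⟨0, ⟨0, by simp, h.zero⟩,
    mem_connectedComponentIn zero_mem⟩
  rintro _ ⟨w, hw, rfl⟩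
  exact Or.inl (h.mem0 hw)

lemma Good.absorb {k : ℕ} {ψ : ℂ → ℂ} (h : Good k ψ) {S : Set ℂ} (hS : IsPreconnected S)
    (hs : ∀ z ∈ S, fBasilica^[2 * k] z ∈ ball (0 : ℂ) (2 / 5))
    (hn : (S ∩ ψ '' ball 0 1).Nonempty) : S ⊆ ψ '' ball 0 1 := by
  refine hS.subset_of_closure_inter_subset (open_image h.diff h.inj) hn ?_
  rintro z ⟨hz, hzS⟩
  have hz2 := hs z hzS
  rw [mem_ball_zero_iff] at hz2
  obtain ⟨c, hc1, hc2⟩ := exists_between hz2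
  have hN : IsOpen {y : ℂ | ‖fBasilica^[2 * k] y‖ < c} :=
    isOpen_lt ((f_cont.iterate _).norm) continuous_const
  have hK1 : {w : ℂ | 2 / 5 * ‖w‖ ^ (2 ^ k) ≤ c} ⊆ ball 0 1 := by
    intro w hw
    have hw : 2 / 5 * ‖w‖ ^ (2 ^ k) ≤ c := hw
    rw [mem_ball_zero_iff]
    by_contra! hge
    have := one_le_pow₀ hge (n := 2 ^ k)
    linarith
  have hK : IsCompact {w : ℂ | 2 / 5 * ‖w‖ ^ (2 ^ k) ≤ c} := by
    refine (isCompact_closedBall (0 : ℂ) 1).of_isClosed_subset ?_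
      (hK1.trans ball_subset_closedBall)
    exact isClosed_le (by fun_prop) continuous_const
  have hKi := (hK.image_of_continuousOn (h.diff.continuousOn.mono hK1)).isClosed
  have h1 : z ∈ closure ({y : ℂ | ‖fBasilica^[2 * k] y‖ < c} ∩ ψ '' ball 0 1) :=
    hN.inter_closure ⟨hc1, hz⟩
  have h2 : {y : ℂ | ‖fBasilica^[2 * k] y‖ < c} ∩ ψ '' ball 0 1 ⊆
      ψ '' {w : ℂ | 2 / 5 * ‖w‖ ^ (2 ^ k) ≤ c} := by
    rintro _ ⟨hy, w, hw, rfl⟩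
    refine ⟨w, ?_, rfl⟩
    have hy : ‖fBasilica^[2 * k] (ψ w)‖ < c := hy
    rw [h.iter w hw, norm_mul, norm_pow] at hy
    norm_num at hy
    exact hy.le
  have h3 := hKi.closure_subset_iff.2 h2 h1
  exact image_mono hK1 h3

lemma cover {K : Set ℂ} (hK : IsCompact K) (hc : IsPreconnected K) (hn : K.Nonempty)
    (hB : K ⊆ B0) : ∃ k ψ, Good k ψ ∧ K ⊆ ψ '' ball 0 1 := by
  obtain ⟨z, hz⟩ := hn
  have hopen : IsOpen B0 := isOpen_basin.connectedComponentIn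
  have hconn : IsConnected B0 := ⟨⟨0, mem_connectedComponentIn zero_mem⟩,
    isPreconnected_connectedComponentIn⟩
  have hp := hopen.isConnected_iff_isPathConnected.1 hconn
  obtain ⟨γ, hγ⟩ := hp.joinedIn 0 (mem_connectedComponentIn zero_mem) z (hB hz)
  have hSc : IsCompact (range γ ∪ K) := (isCompact_range γ.continuous).union hK
  have hSp : IsPreconnected (range γ ∪ K) :=
    (isPreconnected_range γ.continuous).union z ⟨1, by simp⟩ hz hc
  have hSB : range γ ∪ K ⊆ B0 := union_subset (by rintro _ ⟨t, rfl⟩; exact hγ t) hB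
  obtain ⟨m, hm⟩ := compact_iter hSc (hSB.trans B0_sub0)
  obtain ⟨ψ, hψ⟩ := exists_good m
  refine ⟨m, ψ, hψ, ?_⟩
  have := hψ.absorb hSp hm ⟨0, Or.inl ⟨0, by simp⟩, 0, by simp, hψ.zero⟩
  exact subset_union_right.trans this

/-- Iterated lifts of `ψ` through the basilica map that stay away from the critical point. -/
def Lift (ψ : ℂ → ℂ) : ℕ → (ℂ → ℂ) → Prop
  | 0, h => h = ψ
  | n + 1, h => ∃ g, Lift ψ n g ∧ DifferentiableOn ℂ h (ball 0 1) ∧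
      (∀ w ∈ ball (0 : ℂ) 1, h w ^ 2 = g w + 1) ∧ ∀ w ∈ ball (0 : ℂ) 1, 2 / 5 ≤ ‖h w‖

lemma Lift.diff {k n : ℕ} {ψ h : ℂ → ℂ} (hψ : Good k ψ) (hl : Lift ψ n h) :
    DifferentiableOn ℂ h (ball 0 1) := by
  cases n with
  | zero => have : h = ψ := hl
            rw [this]; exact hψ.diff
  | succ n => obtain ⟨g, -, hd, -⟩ := hl; exact hd

lemma Lift.inj {k n : ℕ} {ψ h : ℂ → ℂ} (hψ : Good k ψ) (hl : Lift ψ n h) :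
    InjOn h (ball 0 1) := by
  induction n generalizing h with
  | zero => have : h = ψ := hl
            rw [this]; exact hψ.inj
  | succ n ih =>
    obtain ⟨g, hg, -, he, -⟩ := hl
    intro a ha b hb hab
    apply ih hg ha hb
    have h1 := he a ha
    rw [hab, he b hb] at h1
    exact (add_right_cancel h1).symm

lemma Lift.basin {k n : ℕ} {ψ h : ℂ → ℂ} (hψ : Good k ψ) (hl : Lift ψ n h) {w : ℂ}
    (hw : w ∈ ball (0 : ℂ) 1) : h w ∈ basilicaBasin := by
  induction n generalizing h with
  | zero => have : h = ψ := hl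
            rw [this]; exact Or.inl (hψ.mem0 hw)
  | succ n ih =>
    obtain ⟨g, hg, -, he, -⟩ := hl
    rw [← f_mem, f_apply, he w hw, add_sub_cancel_right]
    exact ih hg

lemma Lift.bd {k n : ℕ} {ψ h : ℂ → ℂ} (hψ : Good k ψ) (hl : Lift ψ n h) (j : ℕ) {w : ℂ}
    (hw : w ∈ ball (0 : ℂ) 1) (hw1 : 43 / 50 ≤ ‖w‖) (hw2 : ‖w‖ ^ (2 ^ j) ≤ 93 / 100) :
    ‖deriv h w‖ ^ 2 ≤ 40000 * (49 / 16) ^ j * (7 / 8) ^ n * (‖h w‖ * ‖h w + 1‖) := by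
  induction n generalizing h with
  | zero => have : h = ψ := hl
            rw [this, pow_zero, mul_one]; exact hψ.bd j w hw hw1 hw2
  | succ n ih =>
    obtain ⟨g, hg, hd, he, hb⟩ := hl
    have ih := ih hg
    have e1 := sq_deriv hd he hw
    have e2 := he w hw
    have e3 := hb w hw
    have n1 : 2 * ‖h w‖ * ‖deriv h w‖ = ‖deriv g w‖ := by rw [← e1]; simp
    have n2 : ‖g w‖ * ‖g w + 1‖ = ‖h w - 1‖ * ‖h w + 1‖ * ‖h w‖ ^ 2 := by
      rw [← norm_mul, ← norm_mul, ← norm_pow, ← norm_mul, ← e2]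
      congr 1; linear_combination -(h w) ^ 2 * e2
    have n3 := sub_one_le e3
    rw [n2, ← n1] at ih
    have hpos : 0 < ‖h w‖ := by linarith
    have n4 : 4 * ‖deriv h w‖ ^ 2 ≤
        40000 * (49 / 16) ^ j * (7 / 8) ^ n * (‖h w - 1‖ * ‖h w + 1‖) := by
      have : 0 < ‖h w‖ ^ 2 := by positivity
      refine le_of_mul_le_mul_right ?_ this
      calc _ = (2 * ‖h w‖ * ‖deriv h w‖) ^ 2 := by ring
        _ ≤ _ := ih
        _ = _ := by ring
    have n5 : 40000 * (49 / 16) ^ j * (7 / 8) ^ n * (‖h w - 1‖ * ‖h w + 1‖) ≤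
        40000 * (49 / 16) ^ j * (7 / 8) ^ n * ((7 / 2 * ‖h w‖) * ‖h w + 1‖) := by gcongr
    rw [pow_succ (7 / 8 : ℝ) n]
    linarith

lemma Lift.neg_one {k n : ℕ} {ψ h : ℂ → ℂ} (hψ : Good k ψ) (hl : Lift ψ n h) {w : ℂ}
    (hw : w ∈ ball (0 : ℂ) 1) (h1 : h w = -1) : n = 1 ∧ w = 0 := by
  rcases n with _ | _ | n
  · exfalso
    have h2 : h = ψ := hl
    rw [h2] at h1
    have := hψ.mem0 hw
    rw [h1] at this
    exact disj _ this neg_one_mem1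
  · obtain ⟨g, hg, -, he, -⟩ := hl
    have h2 : g = ψ := hg
    refine ⟨rfl, hψ.eq_zero hw ?_⟩
    have := he w hw
    rw [h1, h2] at this
    linear_combination -this
  · exfalso
    obtain ⟨g, ⟨g2, -, -, -, hb⟩, -, he, -⟩ := hl
    have h2 := he w hw
    rw [h1] at h2
    have h3 : g w = 0 := by linear_combination -h2
    have := hb w hw
    rw [h3] at this
    norm_num at this

lemma lift_exists {k : ℕ} {ψ : ℂ → ℂ} (hψ : Good k ψ) (n : ℕ) (S : Set ℂ)
    (hS : IsPreconnected S) (hne : S.Nonempty)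
    (h1 : ∀ i < n, ∀ z ∈ S, fBasilica^[i] z ∉ B0)
    (h2 : ∀ z ∈ S, fBasilica^[n] z ∈ ψ '' ball 0 1) :
    ∃ h, Lift ψ n h ∧ S ⊆ h '' ball 0 1 := by
  induction n generalizing S with
  | zero => exact ⟨ψ, rfl, h2⟩
  | succ n ih =>
    obtain ⟨g, hg, hgS⟩ := ih (fBasilica '' S) (hS.image _ f_cont.continuousOn) (hne.image _)
      (by
        rintro i hi _ ⟨z, hz, rfl⟩
        rw [← Function.iterate_succ_apply]
        exact h1 (i + 1) (by omega) z hz)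
      (by
        rintro _ ⟨z, hz, rfl⟩
        rw [← Function.iterate_succ_apply]
        exact h2 z hz)
    obtain ⟨z0, hz0⟩ := hne
    have hz0B : z0 ∉ B0 := h1 0 (by omega) z0 hz0
    have hgd := hg.diff hψ
    have hgne : ∀ w ∈ ball (0 : ℂ) 1, g w + 1 ≠ 0 := by
      intro w hw hgw
      have hgw' : g w = -1 := by linear_combination hgw
      obtain ⟨rfl, rfl⟩ := hg.neg_one hψ hw hgw'
      obtain ⟨g', hg', -, hge, hgb⟩ := hg
      have hg'' : g' = ψ := hg'
      subst hg''
      obtain ⟨q, p, hp, hqd, hq, hq0, hpq, hodd⟩ := good_step hψ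
      have hqne : ∀ {x : ℂ}, x ∈ ball (0 : ℂ) 1 → q x ≠ 0 := by
        intro x hx h0
        have := hq x hx
        rw [← hge x hx, h0] at this
        have h3 := hgb x hx
        have h4 : g x = 0 := by simpa using this.symm
        rw [h4] at h3; norm_num at h3
      have heq : EqOn g q (ball 0 1) :=
        (convex_ball (0 : ℂ) 1).isPreconnected.eq_of_sq_eq hgd.continuousOn hqd.continuousOn
          (fun x hx => by simp only [Pi.pow_apply]; rw [hge x hx, hq x hx]) hqne hw
          (by rw [hgw', hq0])
      obtain ⟨v, hv, hgv⟩ := hgS ⟨z0, hz0, rfl⟩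
      obtain ⟨u, hu⟩ := IsAlgClosed.exists_pow_nat_eq v (n := 2) (by norm_num)
      have hub : u ∈ ball (0 : ℂ) 1 := by
        rw [mem_ball_zero_iff] at hv ⊢
        by_contra! hge
        rw [← hu, norm_pow] at hv
        exact absurd hv (not_lt.2 (one_le_pow₀ hge))
      have e1 := hpq u hub
      rw [hu, ← heq hv, hgv, f_apply, sub_add_cancel] at e1
      apply hz0B
      apply hp.sub_B0
      rcases sq_eq_sq_iff_eq_or_eq_neg.1 e1 with e2 | e2
      · exact ⟨u, hub, e2⟩
      · exact ⟨-u, by simpa using hub, by rw [hodd u hub, e2, neg_neg]⟩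
    have fin : ∀ r : ℂ → ℂ, DifferentiableOn ℂ r (ball 0 1) →
        (∀ w ∈ ball (0 : ℂ) 1, r w ^ 2 = g w + 1) → S ⊆ r '' ball 0 1 →
        ∃ h, Lift ψ (n + 1) h ∧ S ⊆ h '' ball 0 1 := by
      intro r hrd hr hSr
      refine ⟨r, ⟨g, hg, hrd, hr, fun w hw => ?_⟩, hSr⟩
      by_contra! hc
      apply hz0B
      refine sub_B0 (preconn_image hrd) ?_ ⟨r w, ⟨w, hw, rfl⟩, ball_B0 (by simpa using hc)⟩
        (hSr hz0)
      rintro _ ⟨x, hx, rfl⟩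
      rw [← f_mem, f_apply, hr x hx, add_sub_cancel_right]
      exact hg.basin hψ hx
    obtain ⟨r, hrd, hr⟩ := exists_sqrt (fun w => g w + 1) (hgd.add_const 1) hgne
    have hri : InjOn r (ball 0 1) := by
      intro a ha b hb hab
      apply hg.inj hψ ha hb
      have h1 := hr a ha
      rw [hab, hr b hb] at h1
      exact (add_right_cancel h1).symm
    have hnd : DifferentiableOn ℂ (fun w => - r w) (ball 0 1) := hrd.neg
    have hni : InjOn (fun w => - r w) (ball 0 1) := fun a ha b hb hab => hri ha hb (neg_inj.1 hab)
    have hnr : ∀ w ∈ ball (0 : ℂ) 1, (- r w) ^ 2 = g w + 1 := fun w hw => by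
      rw [neg_sq, hr w hw]
    have hdisj : Disjoint (r '' ball 0 1) ((fun w => - r w) '' ball 0 1) := by
      rw [Set.disjoint_left]
      rintro _ ⟨a, ha, rfl⟩ ⟨b, hb, hab⟩
      simp only at hab
      have h3 := hnr b hb
      rw [hab, hr a ha] at h3
      have h4 := hg.inj hψ ha hb (add_right_cancel h3)
      rw [h4] at hab
      have h5 : r b = 0 := by linear_combination (-1 / 2) * hab
      have h6 := hr b hb
      rw [h5] at h6
      exact hgne b hb (by rw [← h6]; norm_num)
    have hsub : S ⊆ r '' ball 0 1 ∪ (fun w => - r w) '' ball 0 1 := by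
      intro z hz
      obtain ⟨v, hv, hgv⟩ := hgS ⟨z, hz, rfl⟩
      have h3 : r v ^ 2 = z ^ 2 := by rw [hr v hv, hgv, f_apply, sub_add_cancel]
      rcases sq_eq_sq_iff_eq_or_eq_neg.1 h3 with e2 | e2
      · exact Or.inl ⟨v, hv, e2⟩
      · exact Or.inr ⟨v, hv, by simp [e2]⟩
    rcases IsPreconnected.subset_or_subset (open_image hrd hri) (open_image hnd hni) hdisj hsub hS
      with h3 | h3
    · exact fin r hrd hr h3
    · exact fin _ hnd hnr h3

end Basilica

namespace Basilica

open Metric Set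

/-- Radii exhausting the unit disk. -/
noncomputable def rad (j : ℕ) : ℝ := 1 - 1 / 10 * (1 / 2) ^ j

lemma rad_lt (j : ℕ) : rad j < 1 := by
  have : (0 : ℝ) < (1 / 2) ^ j := by positivity
  unfold rad; linarith

lemma rad_ge (j : ℕ) : 9 / 10 ≤ rad j := by
  have : ((1 : ℝ) / 2) ^ j ≤ 1 := pow_le_one₀ (by norm_num) (by norm_num)
  unfold rad; linarith

lemma rad_pow (j : ℕ) : rad j ^ (2 ^ j) ≤ 93 / 100 := by
  have h0 : 0 ≤ rad j := le_trans (by norm_num) (rad_ge j)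
  have h1 : rad j ≤ Real.exp (-(1 / 10 * (1 / 2) ^ j)) := by
    have := Real.add_one_le_exp (-(1 / 10 * (1 / 2) ^ j : ℝ))
    unfold rad; linarith
  have h2 : rad j ^ (2 ^ j) ≤ Real.exp (-(1 / 10)) := by
    refine (pow_le_pow_left₀ h0 h1 _).trans (le_of_eq ?_)
    rw [← Real.exp_nat_mul]
    congr 1
    push_cast
    have : (2 : ℝ) ^ j * (1 / 2) ^ j = 1 := by rw [← mul_pow]; norm_num
    linear_combination (-1 / 10 : ℝ) * this
  refine h2.trans ?_
  rw [Real.exp_neg]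
  have h3 := Real.add_one_le_exp (1 / 10 : ℝ)
  have h4 : (Real.exp (1 / 10))⁻¹ ≤ (11 / 10 : ℝ)⁻¹ :=
    inv_anti₀ (by norm_num) (by linarith)
  refine h4.trans (by norm_num)

lemma Lift.deriv_bd {k n : ℕ} {ψ h : ℂ → ℂ} (hψ : Good k ψ) (hl : Lift ψ n h) (j : ℕ) {w : ℂ}
    (hw : ‖w‖ ≤ rad j) : ‖deriv h w‖ ≤ 500 * (19 / 20) ^ n * (7 / 4) ^ j := by
  have hr := rad_ge j
  have hr1 := rad_lt j
  have hd : DifferentiableOn ℂ (deriv h) (ball 0 1) := (Lift.diff hψ hl).deriv isOpen_ball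
  have hsub : closedBall (0 : ℂ) (rad j) ⊆ ball 0 1 := closedBall_subset_ball hr1
  have hrne : rad j ≠ 0 := by linarith
  refine Complex.norm_le_of_forall_mem_frontier_norm_le (U := ball (0 : ℂ) (rad j))
    isBounded_ball (DifferentiableOn.diffContOnCl ?_) ?_ ?_
  · rw [closure_ball _ hrne]
    exact hd.mono hsub
  · intro z hz
    rw [frontier_ball _ hrne, mem_sphere_zero_iff_norm] at hz
    have hz1 : z ∈ ball (0 : ℂ) 1 := by rw [mem_ball_zero_iff]; linarith
    have h1 := Lift.bd hψ hl j hz1 (by linarith) (by rw [hz]; exact rad_pow j)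
    have h2 := basin_norm _ (Lift.basin hψ hl hz1)
    have h3 : ‖h z + 1‖ ≤ 3 := by
      have := norm_add_le (h z) 1
      rw [norm_one] at this
      linarith
    have h4 : ‖h z‖ * ‖h z + 1‖ ≤ 6 := by nlinarith [norm_nonneg (h z), norm_nonneg (h z + 1)]
    have h5 : ((7 : ℝ) / 8) ^ n ≤ ((19 / 20) ^ n) ^ 2 := by
      rw [← pow_mul, mul_comm, pow_mul]
      exact pow_le_pow_left₀ (by norm_num) (by norm_num) n
    have h6 : ((49 : ℝ) / 16) ^ j = ((7 / 4) ^ j) ^ 2 := by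
      rw [← pow_mul, mul_comm, pow_mul]; norm_num
    refine le_of_sq_le_sq ?_ (by positivity)
    calc ‖deriv h z‖ ^ 2 ≤ 40000 * (49 / 16) ^ j * (7 / 8) ^ n * (‖h z‖ * ‖h z + 1‖) := h1
      _ ≤ 40000 * (49 / 16) ^ j * ((19 / 20) ^ n) ^ 2 * 6 := by gcongr
      _ ≤ 250000 * (49 / 16) ^ j * ((19 / 20) ^ n) ^ 2 := by
        have : (0 : ℝ) ≤ (49 / 16) ^ j * ((19 / 20) ^ n) ^ 2 := by positivity
        linarith
      _ = (500 * (19 / 20) ^ n * (7 / 4) ^ j) ^ 2 := by rw [h6]; ring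
  · rw [closure_ball _ hrne, mem_closedBall_zero_iff]
    exact hw

lemma Lift.lip {k n : ℕ} {ψ h : ℂ → ℂ} (hψ : Good k ψ) (hl : Lift ψ n h) (j : ℕ) {w v : ℂ}
    (hw : ‖w‖ ≤ rad j) (hv : ‖v‖ ≤ rad j) :
    ‖h w - h v‖ ≤ 500 * (19 / 20) ^ n * (7 / 4) ^ j * ‖w - v‖ := by
  refine (convex_closedBall (0 : ℂ) (rad j)).norm_image_sub_le_of_norm_deriv_le
    (𝕜 := ℂ) (f := h) (fun x hx => ?_) (fun x hx => ?_) ?_ ?_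
  · rw [mem_closedBall_zero_iff] at hx
    refine (Lift.diff hψ hl).differentiableAt (isOpen_ball.mem_nhds ?_)
    rw [mem_ball_zero_iff]
    exact hx.trans_lt (rad_lt j)
  · rw [mem_closedBall_zero_iff] at hx
    exact Lift.deriv_bd hψ hl j hx
  · rwa [mem_closedBall_zero_iff]
  · rwa [mem_closedBall_zero_iff]

lemma Lift.osc_aux {k n : ℕ} {ψ h : ℂ → ℂ} (hψ : Good k ψ) (hl : Lift ψ n h) (j : ℕ) :
    ∀ w : ℂ, ‖w‖ ≤ rad j → ‖h w - h 0‖ ≤ (19 / 20) ^ n * (900 - 350 * (7 / 8) ^ j) := by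
  induction j with
  | zero =>
    intro w hw
    have h1 := Lift.lip hψ hl 0 hw (v := 0) (by rw [norm_zero]; linarith [rad_ge 0])
    rw [sub_zero, pow_zero, mul_one] at h1
    have h2 : ‖w‖ ≤ 1 := hw.trans (rad_lt 0).le
    have hp : (0 : ℝ) < (19 / 20) ^ n := by positivity
    have : 500 * (19 / 20) ^ n * ‖w‖ ≤ 500 * (19 / 20 : ℝ) ^ n * 1 := by gcongr
    rw [pow_zero]
    linarith
  | succ j ih =>
    intro w hw
    have ha := rad_ge j
    have hb := rad_ge (j + 1)
    have hab : rad (j + 1) - rad j = 1 / 20 * (1 / 2) ^ j := by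
      unfold rad; rw [pow_succ]; ring
    have hq : (0 : ℝ) < (1 / 2) ^ j := by positivity
    have hle : rad j ≤ rad (j + 1) := by linarith
    have hb0 : 0 < rad (j + 1) := by linarith
    set c : ℝ := rad j / rad (j + 1) with hc
    have hc0 : 0 ≤ c := by positivity
    have hc1 : c ≤ 1 := by rw [hc, div_le_one hb0]; exact hle
    have hcb : c * rad (j + 1) = rad j := by rw [hc]; field_simp
    have hv : ‖(c : ℂ) * w‖ ≤ rad j := by
      rw [norm_mul, Complex.norm_real, Real.norm_of_nonneg hc0, ← hcb]
      gcongr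
    have hd : ‖w - (c : ℂ) * w‖ ≤ 1 / 20 * (1 / 2) ^ j := by
      have : w - (c : ℂ) * w = ((1 - c : ℝ) : ℂ) * w := by push_cast; ring
      rw [this, norm_mul, Complex.norm_real, Real.norm_of_nonneg (by linarith), ← hab]
      calc (1 - c) * ‖w‖ ≤ (1 - c) * rad (j + 1) := by
            apply mul_le_mul_of_nonneg_left hw; linarith
        _ = rad (j + 1) - rad j := by linear_combination -hcb
    have h1 := Lift.lip hψ hl (j + 1) hw (hv.trans hle)
    have h2 := ih _ hv
    have h3 : ‖h w - h 0‖ ≤ ‖h w - h (c * w)‖ + ‖h (c * w) - h 0‖ := by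
      have := norm_add_le (h w - h (c * w)) (h (c * w) - h 0)
      rwa [sub_add_sub_cancel] at this
    have h4 : ‖h w - h (c * w)‖ ≤
        500 * (19 / 20) ^ n * (7 / 4) ^ (j + 1) * (1 / 20 * (1 / 2) ^ j) :=
      h1.trans (by gcongr)
    have h5 : (7 / 4 : ℝ) ^ j * (1 / 2) ^ j = (7 / 8) ^ j := by rw [← mul_pow]; norm_num
    have h6 : 500 * (19 / 20 : ℝ) ^ n * (7 / 4) ^ (j + 1) * (1 / 20 * (1 / 2) ^ j)
        = 175 / 4 * ((19 / 20) ^ n * (7 / 8) ^ j) := by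
      rw [← h5, pow_succ (7 / 4 : ℝ) j]; ring
    rw [h6] at h4
    rw [pow_succ (7 / 8 : ℝ) j]
    linarith

lemma Lift.osc {k n : ℕ} {ψ h : ℂ → ℂ} (hψ : Good k ψ) (hl : Lift ψ n h) {w : ℂ}
    (hw : w ∈ ball (0 : ℂ) 1) : ‖h w - h 0‖ ≤ 900 * (19 / 20) ^ n := by
  rw [mem_ball_zero_iff] at hw
  obtain ⟨j, hj⟩ := exists_pow_lt_of_lt_one (show 0 < 1 - ‖w‖ by linarith)
    (show (1 / 2 : ℝ) < 1 by norm_num)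
  have hq : (0 : ℝ) < (1 / 2) ^ j := by positivity
  have h1 := Lift.osc_aux hψ hl j w (by unfold rad; linarith)
  have h2 : (0 : ℝ) ≤ (19 / 20) ^ n * (7 / 8) ^ j := by positivity
  linarith

lemma bubble_sub {F : Set ℂ} (hF : IsBubble F) : F ⊆ basilicaBasin := by
  obtain ⟨z, -, rfl⟩ := hF
  exact connectedComponentIn_subset _ _

lemma bubble_conn {F : Set ℂ} (hF : IsBubble F) : IsConnected F := by
  obtain ⟨z, hz, rfl⟩ := hF
  exact isConnected_connectedComponentIn_iff.2 hz

lemma bubble_open {F : Set ℂ} (hF : IsBubble F) : IsOpen F := by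
  obtain ⟨z, hz, rfl⟩ := hF
  exact isOpen_basin.connectedComponentIn

lemma bubble_bdd {F : Set ℂ} (hF : IsBubble F) : Bornology.IsBounded F :=
  isBounded_basin.subset (bubble_sub hF)

lemma bubble_diam {F : Set ℂ} (hF : IsBubble F) :
    diam F ≤ 1800 * (19 / 20) ^ bubbleGen F := by
  have hsub := bubble_sub hF
  obtain hn | hn := Nat.eq_zero_or_pos (bubbleGen F)
  · rw [hn]
    refine diam_le_of_forall_dist_le (by positivity) fun x hx y hy => ?_
    have h1 := basin_norm x (hsub hx)
    have h2 := basin_norm y (hsub hy)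
    have h3 := dist_le_norm_add_norm x y
    norm_num
    linarith
  · refine diam_le_of_forall_dist_le (by positivity) fun p hp q hq => ?_
    have hmem : bubbleGen F ∈ {n : ℕ | fBasilica^[n] '' F ⊆ B0} :=
      Nat.sInf_mem (Nat.nonempty_of_pos_sInf hn)
    have hnot : ∀ i < bubbleGen F, ∀ z ∈ F, fBasilica^[i] z ∉ B0 := by
      intro i hi z hz hz0
      refine Nat.notMem_of_lt_sInf hi (sub_B0 ?_ ?_ ⟨_, mem_image_of_mem _ hz, hz0⟩)
      · exact (bubble_conn hF).isPreconnected.image _ (f_cont.iterate i).continuousOn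
      · rintro _ ⟨x, hx, rfl⟩
        exact (iter_mem i x).2 (hsub hx)
    have hpc := (bubble_open hF).isConnected_iff_isPathConnected.1 (bubble_conn hF)
    obtain ⟨γ, hγ⟩ := hpc.joinedIn p hp q hq
    have hSF : range γ ⊆ F := by rintro _ ⟨t, rfl⟩; exact hγ t
    have hSc : IsCompact (range γ) := isCompact_range γ.continuous
    have hSp : IsPreconnected (range γ) := isPreconnected_range γ.continuous
    have hSn : (range γ).Nonempty := range_nonempty _
    have hcont := f_cont.iterate (bubbleGen F)
    obtain ⟨k, ψ, hψ, hcov⟩ := cover (hSc.image hcont) (hSp.image _ hcont.continuousOn)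
      (hSn.image _) ((image_mono hSF).trans hmem)
    obtain ⟨h, hl, hh⟩ := lift_exists hψ (bubbleGen F) (range γ) hSp hSn
      (fun i hi z hz => hnot i hi z (hSF hz)) (fun z hz => hcov (mem_image_of_mem _ hz))
    obtain ⟨a, ha, rfl⟩ := hh ⟨0, γ.source⟩
    obtain ⟨b, hb, rfl⟩ := hh ⟨1, γ.target⟩
    have h1 := Lift.osc hψ hl ha
    have h2 := Lift.osc hψ hl hb
    rw [← dist_eq_norm] at h1 h2
    have h3 := dist_triangle_right (h a) (h b) (h 0)
    linarith

lemma ray_lands {F : ℕ → Set ℂ} (hF : IsBubbleRay F) :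
    ∃! x : ℂ, ∀ ε > (0 : ℝ), ∃ K : ℕ, ∀ k ≥ K, F k ⊆ ball x ε := by
  obtain ⟨hb, hc, hg⟩ := hF
  have hk : ∀ k, k ≤ bubbleGen (F k) := (strictMono_nat_of_lt_succ hg).id_le
  have hdiam : ∀ k, diam (F k) ≤ 1800 * (19 / 20) ^ k := fun k =>
    (bubble_diam (hb k)).trans (by
      have := pow_le_pow_of_le_one (show (0 : ℝ) ≤ 19 / 20 by norm_num) (by norm_num) (hk k)
      linarith)
  choose x hx using fun k => (bubble_conn (hb k)).nonempty
  have hd : ∀ k, ∀ y ∈ closure (F k), dist (x k) y ≤ 1800 * (19 / 20) ^ k := by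
    intro k y hy
    refine le_trans ?_ (hdiam k)
    rw [← diam_closure]
    exact dist_le_diam_of_mem (bubble_bdd (hb k)).closure (subset_closure (hx k)) hy
  have hu : ∀ k, dist (x k) (x (k + 1)) ≤ 3600 * (19 / 20) ^ k := by
    intro k
    obtain ⟨y, hy⟩ := hc k
    have hy' : y ∈ closure (F k) ∩ closure (F (k + 1)) := by rw [hy]; exact mem_singleton y
    have h1 := hd k y hy'.1
    have h2 := hd (k + 1) y hy'.2
    have h3 := dist_triangle_right (x k) (x (k + 1)) y
    have hp : (0 : ℝ) < (19 / 20) ^ k := by positivity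
    rw [pow_succ] at h2
    linarith
  have hcau := cauchySeq_of_le_geometric (19 / 20 : ℝ) 3600 (by norm_num) hu
  obtain ⟨l, hlim⟩ := cauchySeq_tendsto_of_complete hcau
  have hl := dist_le_of_le_geometric_of_tendsto (19 / 20 : ℝ) 3600 (by norm_num) hu hlim
  refine ⟨l, ?_, ?_⟩
  · intro ε hε
    obtain ⟨K, hK⟩ := exists_pow_lt_of_lt_one (show 0 < ε / 80000 by positivity)
      (show (19 / 20 : ℝ) < 1 by norm_num)
    refine ⟨K, fun k hkK y hy => ?_⟩
    have h1 := hd k y (subset_closure hy)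
    have h2 := hl k
    have h3 := dist_triangle_left y l (x k)
    have h4 := pow_le_pow_of_le_one (show (0 : ℝ) ≤ 19 / 20 by norm_num) (by norm_num) hkK
    rw [mem_ball]
    have h5 : 3600 * (19 / 20 : ℝ) ^ k / (1 - 19 / 20) = 72000 * (19 / 20) ^ k := by ring
    rw [h5] at h2
    linarith
  · intro y hy
    refine tendsto_nhds_unique (f := x) (l := atTop) ?_ hlim
    rw [Metric.tendsto_atTop]
    intro ε hε
    obtain ⟨K, hK⟩ := hy ε hε
    exact ⟨K, fun k hk => hK k hk (hx k)⟩

end Basilica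

/-- There are constants `s ∈ (0,1)` and `C > 0` with `diam F ≤ C·s^{Gen F}` for every bubble
`F`; in particular every infinite bubble ray converges to a unique point in the Hausdorff
sense. -/
theorem bubble_diam_exponential_and_rays_land :
    (∃ s : ℝ, s ∈ Set.Ioo (0 : ℝ) 1 ∧ ∃ C : ℝ, 0 < C ∧
      ∀ F : Set ℂ, IsBubble F → Metric.diam F ≤ C * s ^ bubbleGen F) ∧
    (∀ F : ℕ → Set ℂ, IsBubbleRay F →
      ∃! x : ℂ, ∀ ε > (0 : ℝ), ∃ K : ℕ, ∀ k ≥ K, F k ⊆ Metric.ball x ε) := by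
  exact ⟨⟨19 / 20, ⟨by norm_num, by norm_num⟩, 1800, by norm_num,
    fun F hF => Basilica.bubble_diam hF⟩, fun F hF => Basilica.ray_lands hF⟩
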